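/- arXiv:1105.3505 — 3 statements merged into one kernel-verified Lean document; each statement's English description precedes it below -/
import Mathlib

section
/- For every m = (m₁, m₂) ∈ ℤ², the function t = (t₁, t₂) ↦ (cos(t₁m₁ + t₂m₂) − 1) / (4 sin²(t₁/2) + 4 sin²(t₂/2)) is Lebesgue integrable on the square [-π, π]²; in particular the lattice fundamental solution φ(m) = (1/(2π)²) ∫_{[-π,π]²} (cos(t₁m₁ + t₂m₂) − 1) / (4 sin²(t₁/2) + 4 sin²(t₂/2)) dt₁ dt₂ is well defined. -/
open Real MeasureTheory Filter

/-- The integrand of the lattice fundamental solution. -/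
noncomputable def latticeKernel (m : ℤ × ℤ) (t : ℝ × ℝ) : ℝ :=
  (Real.cos (t.1 * (m.1 : ℝ) + t.2 * (m.2 : ℝ)) - 1) /
    (4 * Real.sin (t.1 / 2) ^ 2 + 4 * Real.sin (t.2 / 2) ^ 2)

theorem sq_le_pi_sq_mul_sin_half_sq {x : ℝ} (hx : x ∈ Set.Icc (-π) π) :
    x ^ 2 ≤ π ^ 2 * Real.sin (x / 2) ^ 2 := by
  have h := Real.mul_abs_le_abs_sin (x := x / 2)
    (abs_le.2 ⟨by linarith [hx.1], by linarith [hx.2]⟩)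
  have h' : |x| ≤ |π * Real.sin (x / 2)| := by
    rw [abs_mul, abs_of_pos pi_pos]
    calc |x| = π * (2 / π * |x / 2|) := by
          rw [abs_div, abs_two]
          field_simp
      _ ≤ π * |Real.sin (x / 2)| := by gcongr
  simpa only [mul_pow] using sq_le_sq.2 h'

theorem norm_latticeKernel_le (m : ℤ × ℤ) {t : ℝ × ℝ}
    (ht : t ∈ Set.Icc (-π) π ×ˢ Set.Icc (-π) π) :
    ‖latticeKernel m t‖ ≤ π ^ 2 * ((m.1 : ℝ) ^ 2 + (m.2 : ℝ) ^ 2) / 8 := by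
  have hden : 0 ≤ 4 * Real.sin (t.1 / 2) ^ 2 + 4 * Real.sin (t.2 / 2) ^ 2 := by positivity
  rw [latticeKernel, norm_div, Real.norm_of_nonneg hden]
  refine div_le_of_le_mul₀ hden (by positivity) ?_
  rw [Real.norm_of_nonpos (sub_nonpos.2 (Real.cos_le_one _))]
  have hcos := Real.one_sub_sq_div_two_le_cos (x := t.1 * (m.1 : ℝ) + t.2 * (m.2 : ℝ))
  have hsum := add_le_add (sq_le_pi_sq_mul_sin_half_sq ht.1) (sq_le_pi_sq_mul_sin_half_sq ht.2)
  have hmul := mul_le_mul_of_nonneg_left hsum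
    (add_nonneg (sq_nonneg (m.1 : ℝ)) (sq_nonneg (m.2 : ℝ)))
  linarith [sq_nonneg (t.1 * (m.2 : ℝ) - t.2 * (m.1 : ℝ))]

theorem measurable_latticeKernel (m : ℤ × ℤ) : Measurable (latticeKernel m) := by
  unfold latticeKernel
  fun_prop

/-- The integrand of the lattice fundamental solution is Lebesgue integrable on the
square `[-π, π]²`, so that `φ(m)` is well defined. -/
theorem lattice_kernel_integrable (m : ℤ × ℤ) :
    MeasureTheory.IntegrableOn (latticeKernel m)
      (Set.Icc (-Real.pi) Real.pi ×ˢ Set.Icc (-Real.pi) Real.pi) MeasureTheory.volume :=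
  Measure.integrableOn_of_bounded
    (isCompact_Icc.prod isCompact_Icc).measure_lt_top.ne
    (measurable_latticeKernel m).aestronglyMeasurable
    ((ae_restrict_iff' (measurableSet_Icc.prod measurableSet_Icc)).2
      (ae_of_all _ fun _ ht => norm_latticeKernel_le m ht))
end

section
/- The lattice fundamental solution φ is a fundamental solution of the discrete Laplace operator: for every m ∈ ℤ², [Aφ](m) = 4φ(m) − φ(m+e₁) − φ(m−e₁) − φ(m+e₂) − φ(m−e₂) equals 1 if m = (0,0) and equals 0 otherwise. -/
open Real MeasureTheory Filter

/-- The lattice fundamental solution `φ`. -/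
noncomputable def phi (m : ℤ × ℤ) : ℝ :=
  (1 / (2 * Real.pi) ^ 2) *
    ∫ t in Set.Icc (-Real.pi) Real.pi ×ˢ Set.Icc (-Real.pi) Real.pi, latticeKernel m t
/-- The discrete Laplace operator on `ℤ²`. -/
noncomputable def discLap (u : ℤ × ℤ → ℝ) (m : ℤ × ℤ) : ℝ :=
  4 * u m - u (m + (1, 0)) - u (m - (1, 0)) - u (m + (0, 1)) - u (m - (0, 1))

/-- The square `[-π, π]²` over which the lattice fundamental solution is integrated. -/
abbrev piBox : Set (ℝ × ℝ) :=
  Set.Icc (-Real.pi) Real.pi ×ˢ Set.Icc (-Real.pi) Real.pi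

theorem four_mul_sin_half_sq (x : ℝ) : 4 * Real.sin (x / 2) ^ 2 = 2 - 2 * Real.cos x := by
  rw [Real.sin_sq_eq_half_sub, mul_div_cancel₀ x two_ne_zero]
  ring

theorem mul_sq_le_four_mul_sin_half_sq {x : ℝ} (hx : x ∈ Set.Icc (-Real.pi) Real.pi) :
    4 / Real.pi ^ 2 * x ^ 2 ≤ 4 * Real.sin (x / 2) ^ 2 := by
  have h := Real.cos_le_one_sub_mul_cos_sq (abs_le.2 hx)
  rw [four_mul_sin_half_sq]
  linear_combination 2 * h

theorem mul_sq_add_sq_le_symbol {t : ℝ × ℝ} (ht : t ∈ piBox) :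
    4 / Real.pi ^ 2 * (t.1 ^ 2 + t.2 ^ 2) ≤
      4 * Real.sin (t.1 / 2) ^ 2 + 4 * Real.sin (t.2 / 2) ^ 2 := by
  rw [mul_add]
  exact add_le_add (mul_sq_le_four_mul_sin_half_sq ht.1) (mul_sq_le_four_mul_sin_half_sq ht.2)

theorem symbol_ne_zero {t : ℝ × ℝ} (ht : t ∈ piBox) (h0 : t ≠ 0) :
    4 * Real.sin (t.1 / 2) ^ 2 + 4 * Real.sin (t.2 / 2) ^ 2 ≠ 0 := by
  refine ((mul_pos (by positivity) ?_).trans_le (mul_sq_add_sq_le_symbol ht)).ne'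
  have h : t.1 ≠ 0 ∨ t.2 ≠ 0 := by
    contrapose! h0
    exact Prod.ext h0.1 h0.2
  rcases h with h | h <;> positivity

theorem abs_latticeKernel_le (m : ℤ × ℤ) {t : ℝ × ℝ} (ht : t ∈ piBox) :
    |latticeKernel m t| ≤ ((m.1 : ℝ) ^ 2 + (m.2 : ℝ) ^ 2) * Real.pi ^ 2 / 8 := by
  have hcos := Real.one_sub_sq_div_two_le_cos (x := t.1 * (m.1 : ℝ) + t.2 * (m.2 : ℝ))
  have hC : 0 ≤ ((m.1 : ℝ) ^ 2 + (m.2 : ℝ) ^ 2) * Real.pi ^ 2 / 8 := by positivity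
  rw [latticeKernel, abs_div, abs_of_nonpos (sub_nonpos.2 (Real.cos_le_one _)),
    abs_of_nonneg (by positivity)]
  refine div_le_of_le_mul₀ (by positivity) hC ?_
  refine le_trans ?_ (mul_le_mul_of_nonneg_left (mul_sq_add_sq_le_symbol ht) hC)
  have : ((m.1 : ℝ) ^ 2 + (m.2 : ℝ) ^ 2) * Real.pi ^ 2 / 8 *
      (4 / Real.pi ^ 2 * (t.1 ^ 2 + t.2 ^ 2)) =
      ((m.1 : ℝ) ^ 2 + (m.2 : ℝ) ^ 2) * (t.1 ^ 2 + t.2 ^ 2) / 2 := by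
    field_simp
    ring
  rw [this]
  nlinarith [sq_nonneg (t.1 * (m.2 : ℝ) - t.2 * (m.1 : ℝ))]

theorem integrableOn_latticeKernel (m : ℤ × ℤ) : IntegrableOn (latticeKernel m) piBox := by
  refine IntegrableOn.of_bound (isCompact_Icc.prod isCompact_Icc).measure_lt_top ?_ _
    (ae_restrict_of_forall_mem (measurableSet_Icc.prod measurableSet_Icc)
      fun t ht => abs_latticeKernel_le m ht)
  refine Measurable.aestronglyMeasurable ?_
  unfold latticeKernel
  fun_prop

theorem discLap_latticeKernel (m : ℤ × ℤ) {t : ℝ × ℝ} (ht : t ∈ piBox) (h0 : t ≠ 0) :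
    discLap (fun n => latticeKernel n t) m =
      Real.cos (t.1 * (m.1 : ℝ) + t.2 * (m.2 : ℝ)) := by
  have hD := symbol_ne_zero ht h0
  simp only [discLap, latticeKernel, ← sub_div, mul_div_assoc']
  rw [div_eq_iff hD, four_mul_sin_half_sq, four_mul_sin_half_sq]
  simp only [Prod.fst_add, Prod.snd_add, Prod.fst_sub, Prod.snd_sub, Int.cast_add, Int.cast_sub,
    Int.cast_one, add_zero, sub_zero, mul_add, mul_sub, mul_one]
  have e1 : t.1 * (m.1 : ℝ) + t.1 + t.2 * m.2 = t.1 * m.1 + t.2 * m.2 + t.1 := by ring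
  have e2 : t.1 * (m.1 : ℝ) - t.1 + t.2 * m.2 = t.1 * m.1 + t.2 * m.2 - t.1 := by ring
  have e3 : t.1 * (m.1 : ℝ) + (t.2 * m.2 + t.2) = t.1 * m.1 + t.2 * m.2 + t.2 := by ring
  have e4 : t.1 * (m.1 : ℝ) + (t.2 * m.2 - t.2) = t.1 * m.1 + t.2 * m.2 - t.2 := by ring
  rw [e1, e2, e3, e4]
  generalize t.1 * (m.1 : ℝ) + t.2 * m.2 = θ
  simp only [Real.cos_add, Real.cos_sub]
  ring

theorem discLap_phi_eq_integral (m : ℤ × ℤ) :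
    discLap phi m = (1 / (2 * Real.pi) ^ 2) *
      ∫ t in piBox, discLap (fun n => latticeKernel n t) m := by
  have h := integrableOn_latticeKernel
  simp only [discLap]
  rw [integral_sub, integral_sub, integral_sub, integral_sub, integral_const_mul]
  · simp only [phi]
    ring
  · exact (h _).const_mul 4
  · exact h _
  · exact ((h _).const_mul 4).sub (h _)
  · exact h _
  · exact (((h _).const_mul 4).sub (h _)).sub (h _)
  · exact h _
  · exact ((((h _).const_mul 4).sub (h _)).sub (h _)).sub (h _)
  · exact h _

theorem setIntegral_cos_mul_int (k : ℤ) :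
    ∫ x in Set.Icc (-Real.pi) Real.pi, Real.cos (x * (k : ℝ)) =
      if k = 0 then 2 * Real.pi else 0 := by
  rw [integral_Icc_eq_integral_Ioc,
    ← intervalIntegral.integral_of_le (neg_le_self Real.pi_pos.le)]
  split_ifs with hk
  · simp [hk, two_mul]
  · rw [intervalIntegral.integral_comp_mul_right _ (Int.cast_ne_zero.2 hk), integral_cos,
      neg_mul, Real.sin_neg, mul_comm, Real.sin_int_mul_pi]
    simp

theorem setIntegral_sin_mul_int (k : ℤ) :
    ∫ x in Set.Icc (-Real.pi) Real.pi, Real.sin (x * (k : ℝ)) = 0 := by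
  rw [integral_Icc_eq_integral_Ioc,
    ← intervalIntegral.integral_of_le (neg_le_self Real.pi_pos.le)]
  rcases eq_or_ne k 0 with rfl | hk
  · simp
  · rw [intervalIntegral.integral_comp_mul_right _ (Int.cast_ne_zero.2 hk), integral_sin]
    simp

theorem setIntegral_cos_mul_int_add_mul_int (m : ℤ × ℤ) :
    ∫ t in piBox, Real.cos (t.1 * (m.1 : ℝ) + t.2 * (m.2 : ℝ)) =
      if m = (0, 0) then (2 * Real.pi) ^ 2 else 0 := by
  have hint : ∀ f : ℝ × ℝ → ℝ, Continuous f → IntegrableOn f piBox := fun f hf =>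
    hf.continuousOn.integrableOn_compact (isCompact_Icc.prod isCompact_Icc)
  simp only [Real.cos_add]
  rw [integral_sub (hint _ (by fun_prop)) (hint _ (by fun_prop)), Measure.volume_eq_prod,
    setIntegral_prod_mul (fun x => Real.cos (x * (m.1 : ℝ))) (fun y => Real.cos (y * (m.2 : ℝ))),
    setIntegral_prod_mul (fun x => Real.sin (x * (m.1 : ℝ))) (fun y => Real.sin (y * (m.2 : ℝ))),
    setIntegral_sin_mul_int, setIntegral_cos_mul_int, setIntegral_cos_mul_int, zero_mul, sub_zero,
    ite_zero_mul_ite_zero, sq]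
  simp only [Prod.ext_iff]

/-- `φ` is a fundamental solution of the discrete Laplace operator:
`[Aφ](m) = δ₀(m)`. -/
theorem discLap_phi (m : ℤ × ℤ) :
    discLap phi m = if m = (0, 0) then 1 else 0 := by
  have hae : ∀ᵐ t : ℝ × ℝ ∂volume.restrict piBox, discLap (fun n => latticeKernel n t) m =
      Real.cos (t.1 * (m.1 : ℝ) + t.2 * (m.2 : ℝ)) := by
    filter_upwards [ae_restrict_mem (measurableSet_Icc.prod measurableSet_Icc),
      ae_restrict_of_ae (Measure.ae_ne volume (0 : ℝ × ℝ))] with t ht h0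
    exact discLap_latticeKernel m ht h0
  rw [discLap_phi_eq_integral, integral_congr_ae hae, setIntegral_cos_mul_int_add_mul_int, mul_ite,
    mul_zero, one_div_mul_cancel (by positivity)]
end

section
/- If u : ℤ² → ℝ satisfies [Au](m) = 0 for all m ∈ ℤ² and u(m) → 0 as |m| = √(m₁² + m₂²) → ∞, then u is identically zero. -/
open Real MeasureTheory Filter

/-- The Euclidean norm `|m| = √(m₁² + m₂²)` of a lattice point. -/
noncomputable def latNorm (m : ℤ × ℤ) : ℝ :=
  Real.sqrt ((m.1 : ℝ) ^ 2 + (m.2 : ℝ) ^ 2)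

/-- Convolution with the lattice fundamental solution: `[Sf](m) = Σₙ φ(m−n) f(n)`. -/
noncomputable def latConv (f : ℤ × ℤ → ℝ) (m : ℤ × ℤ) : ℝ :=
  ∑ᶠ n : ℤ × ℤ, phi (m - n) * f n

/-- The Euclidean norm tends to infinity along the cofinite filter of the lattice. -/
theorem tendsto_latNorm_cofinite : Tendsto latNorm cofinite atTop := by
  have h : Tendsto (fun m : ℤ × ℤ => ‖m‖) cofinite atTop := by
    simpa only [cocompact_eq_cofinite] using tendsto_norm_cocompact_atTop (E := ℤ × ℤ)
  refine tendsto_atTop_mono (fun m => ?_) h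
  rw [Prod.norm_def, Int.norm_eq_abs, Int.norm_eq_abs]
  exact max_le (Real.abs_le_sqrt (by nlinarith [sq_nonneg (m.2 : ℝ)]))
    (Real.abs_le_sqrt (by nlinarith [sq_nonneg (m.1 : ℝ)]))

/-- A discrete harmonic function attaining its maximum at `m` attains it along a whole ray. -/
theorem eq_max_along_ray {u : ℤ × ℤ → ℝ} (hu : ∀ m, discLap u m = 0) {m : ℤ × ℤ}
    (hm : ∀ n, u n ≤ u m) (k : ℕ) : u (m + ((k : ℤ), 0)) = u m := by
  induction k with
  | zero => exact congrArg u (add_zero m)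
  | succ k ih =>
    have h := hu (m + ((k : ℤ), 0))
    have hstep : m + (((k + 1 : ℕ) : ℤ), (0 : ℤ)) = m + ((k : ℤ), 0) + (1, 0) := by
      simp [add_assoc]
    rw [hstep]
    unfold discLap at h
    linarith [hm (m + ((k : ℤ), 0) + (1, 0)), hm (m + ((k : ℤ), 0) - (1, 0)),
      hm (m + ((k : ℤ), 0) + (0, 1)), hm (m + ((k : ℤ), 0) - (0, 1))]

/-- A discrete harmonic function vanishing at infinity is nowhere positive. -/
theorem nonpos_of_discLap_eq_zero {u : ℤ × ℤ → ℝ} (hu : ∀ m, discLap u m = 0)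
    (hdecay : Tendsto u cofinite (nhds 0)) (m : ℤ × ℤ) : u m ≤ 0 := by
  by_contra! hpos
  obtain ⟨M, hM⟩ : ∃ M, ∀ n, u n ≤ u M := by
    refine (continuous_of_discreteTopology (f := u)).exists_forall_ge' m ?_
    rw [cocompact_eq_cofinite]
    exact hdecay.eventually_le_const hpos
  have hray : Tendsto (fun k : ℕ => M + ((k : ℤ), (0 : ℤ))) atTop cofinite := by
    rw [← Nat.cofinite_eq_atTop]
    refine Function.Injective.tendsto_cofinite fun a b hab => ?_
    simpa using hab
  have hlim := hdecay.comp hray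
  simp only [Function.comp_def, eq_max_along_ray hu hM, tendsto_const_nhds_iff] at hlim
  linarith [hM m]

/-- Uniqueness: a discrete harmonic function on `ℤ²` that decays at infinity
vanishes identically. -/
theorem discLap_uniqueness (u : ℤ × ℤ → ℝ)
    (hu : ∀ m : ℤ × ℤ, discLap u m = 0)
    (hdecay : Filter.Tendsto u (Filter.comap latNorm Filter.atTop) (nhds 0)) :
    ∀ m : ℤ × ℤ, u m = 0 := by
  have hu0 : Tendsto u cofinite (nhds 0) :=
    hdecay.comp (tendsto_comap_iff.2 tendsto_latNorm_cofinite)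
  have hneg : ∀ m, discLap (-u) m = 0 := fun m => by
    have h := hu m
    simp only [discLap, Pi.neg_apply] at h ⊢
    linarith
  intro m
  refine le_antisymm (nonpos_of_discLap_eq_zero hu hu0 m) ?_
  have h := nonpos_of_discLap_eq_zero hneg (by simpa [Pi.neg_def] using hu0.neg) m
  simpa using h
end
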